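/- arXiv:1911.02293 — 2 statements merged into one kernel-verified Lean document; each statement's English description precedes it below -/
import Mathlib

section
/- Let ψ : ℝ^d → ℝ satisfy the approximate-Dirac assumptions of order k with support radius r0, and let δ_ε(x) := ε^{-d} ψ(x/ε). There exists a constant C, depending only on ψ, d and s, such that for every integer s with 1 ≤ s ≤ k + 1, every ε > 0, and every smooth compactly supported function v : ℝ^d → ℝ, ‖v − δ_ε ⋆ v‖_{L²(ℝ^d)} ≤ C ε^s Σ_{|β| = s} ‖D^β v‖_{L²(ℝ^d)}, where the sum is over all multi-indices β of total order s and D^β v denotes the corresponding iterated partial derivative of v. -/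
open MeasureTheory

/-- The scaled kernel `δ_ε(x) = ε^{-d} ψ(x/ε)`. -/
noncomputable def scaledKernel (d : ℕ) (ψ : EuclideanSpace ℝ (Fin d) → ℝ) (ε : ℝ)
    (x : EuclideanSpace ℝ (Fin d)) : ℝ :=
  (ε ^ d)⁻¹ * ψ (ε⁻¹ • x)

/-- Partial derivative in the `i`-th coordinate direction. -/
noncomputable def pderivI {d : ℕ} (i : Fin d) (f : EuclideanSpace ℝ (Fin d) → ℝ)
    (x : EuclideanSpace ℝ (Fin d)) : ℝ :=
  fderiv ℝ f x (EuclideanSpace.single i 1)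

/-- Iterated partial derivative `D^β` associated with the multi-index `β`. -/
noncomputable def Dmulti {d : ℕ} (β : Fin d → ℕ) (f : EuclideanSpace ℝ (Fin d) → ℝ) :
    EuclideanSpace ℝ (Fin d) → ℝ :=
  ((List.ofFn fun i : Fin d => fun g : EuclideanSpace ℝ (Fin d) → ℝ =>
      (pderivI i)^[β i] g).foldr (· ∘ ·) id) f

/-- The space of smooth real functions on `ℝ^d`. -/
def smoothFunctions (d : ℕ) : Submodule ℝ (EuclideanSpace ℝ (Fin d) → ℝ) where
  carrier := {f | ContDiff ℝ (⊤ : ℕ∞) f}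
  add_mem' {f g} hf hg := by
    simp only [Set.mem_ofPred_eq] at hf hg ⊢
    exact hf.add hg
  zero_mem' := by
    simp only [Set.mem_ofPred_eq]
    exact contDiff_const
  smul_mem' c f hf := by
    simp only [Set.mem_ofPred_eq] at hf ⊢
    exact hf.const_smul c

theorem contDiff_coe_smoothFunctions {d : ℕ} (f : smoothFunctions d) :
    ContDiff ℝ (⊤ : ℕ∞) (f : EuclideanSpace ℝ (Fin d) → ℝ) := f.2

theorem differentiable_coe_smoothFunctions {d : ℕ} (f : smoothFunctions d) :
    Differentiable ℝ (f : EuclideanSpace ℝ (Fin d) → ℝ) :=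
  (contDiff_coe_smoothFunctions f).differentiable (by simp)

theorem contDiff_pderivI {d : ℕ} (i : Fin d) {f : EuclideanSpace ℝ (Fin d) → ℝ}
    (hf : ContDiff ℝ (⊤ : ℕ∞) f) : ContDiff ℝ (⊤ : ℕ∞) (pderivI i f) :=
  (hf.fderiv_right (m := (⊤ : ℕ∞)) (by simp)).clm_apply contDiff_const

/-- The partial derivative as an endomorphism of the space of smooth functions. -/
noncomputable def pderivEnd {d : ℕ} (i : Fin d) : Module.End ℝ (smoothFunctions d) where
  toFun f := ⟨pderivI i f, contDiff_pderivI i f.2⟩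
  map_add' f g := by
    ext x
    simp [pderivI, fderiv_add (differentiable_coe_smoothFunctions f x)
      (differentiable_coe_smoothFunctions g x)]
  map_smul' c f := by
    ext x
    simp [pderivI, fderiv_const_smul (differentiable_coe_smoothFunctions f x)]

theorem coe_pderivEnd {d : ℕ} (i : Fin d) (f : smoothFunctions d) :
    (pderivEnd i f : EuclideanSpace ℝ (Fin d) → ℝ) = pderivI i f := rfl

theorem pderivI_pderivI {d : ℕ} (i j : Fin d) {f : EuclideanSpace ℝ (Fin d) → ℝ}
    (hf : ContDiff ℝ (⊤ : ℕ∞) f) (x : EuclideanSpace ℝ (Fin d)) :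
    pderivI i (pderivI j f) x =
      fderiv ℝ (fderiv ℝ f) x (EuclideanSpace.single i 1) (EuclideanSpace.single j 1) := by
  have h : DifferentiableAt ℝ (fderiv ℝ f) x :=
    ((hf.fderiv_right (m := (⊤ : ℕ∞)) (by simp)).differentiable (by simp)) x
  unfold pderivI
  rw [fderiv_clm_apply h (differentiableAt_const _)]
  simp

theorem commute_pderivEnd {d : ℕ} (i j : Fin d) : Commute (pderivEnd i) (pderivEnd j) := by
  refine LinearMap.ext fun f => Subtype.ext <| funext fun x => ?_
  have hsymm := (contDiff_coe_smoothFunctions f).contDiffAt (x := x).isSymmSndFDerivAt (by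
    simpa using WithTop.coe_le_coe.2 (le_top (a := (2 : ℕ∞))))
  simp only [Module.End.mul_apply, coe_pderivEnd]
  rw [pderivI_pderivI i j f.2, pderivI_pderivI j i f.2]
  exact hsymm _ _

theorem coe_pderivEnd_pow {d : ℕ} (i : Fin d) (n : ℕ) (f : smoothFunctions d) :
    ((pderivEnd i ^ n) f : EuclideanSpace ℝ (Fin d) → ℝ) = (pderivI i)^[n] f := by
  induction n with
  | zero => rfl
  | succ n ih => rw [pow_succ', Module.End.mul_apply, coe_pderivEnd, ih,
      Function.iterate_succ_apply']

theorem coe_prod_pderivEnd_pow {d : ℕ} (β : Fin d → ℕ) (f : smoothFunctions d) :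
    ((((List.finRange d).map fun i => pderivEnd i ^ β i).prod f : smoothFunctions d) :
      EuclideanSpace ℝ (Fin d) → ℝ) = Dmulti β f := by
  rw [Dmulti, List.ofFn_eq_map]
  induction List.finRange d with
  | nil => rfl
  | cons i l ih =>
    simp only [List.map_cons, List.prod_cons, Module.End.mul_apply, List.foldr_cons,
      Function.comp_apply, coe_pderivEnd_pow, ih]

theorem contDiff_Dmulti {d : ℕ} (β : Fin d → ℕ) {f : EuclideanSpace ℝ (Fin d) → ℝ}
    (hf : ContDiff ℝ (⊤ : ℕ∞) f) : ContDiff ℝ (⊤ : ℕ∞) (Dmulti β f) := by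
  rw [← coe_prod_pderivEnd_pow β ⟨f, hf⟩]
  exact contDiff_coe_smoothFunctions _

/-- The derivative in the direction `h` as an endomorphism of the space of smooth functions. -/
noncomputable def dirDerivEnd {d : ℕ} (h : EuclideanSpace ℝ (Fin d)) :
    Module.End ℝ (smoothFunctions d) :=
  ∑ i, h i • pderivEnd i

theorem dirDerivEnd_apply {d : ℕ} (h : EuclideanSpace ℝ (Fin d)) (f : smoothFunctions d)
    (x : EuclideanSpace ℝ (Fin d)) :
    (dirDerivEnd h f : EuclideanSpace ℝ (Fin d) → ℝ) x = fderiv ℝ f x h := by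
  have hh : h = ∑ i, h i • EuclideanSpace.single i (1 : ℝ) := by
    ext j
    simp [Finset.sum_apply, Pi.single_apply]
  conv_rhs => rw [hh, map_sum]
  simp [dirDerivEnd, coe_pderivEnd, pderivI, LinearMap.sum_apply, Finset.sum_apply]

theorem List.prod_map_smul_eq {R A ι : Type*} [CommSemiring R] [Semiring A] [Algebra R A]
    (l : List ι) (c : ι → R) (f : ι → A) :
    (l.map fun i => c i • f i).prod = (l.map c).prod • (l.map f).prod := by
  induction l with
  | nil => simp
  | cons i l ih => simp only [List.map_cons, List.prod_cons, ih, smul_mul_smul_comm]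

theorem dirDerivEnd_pow_apply {d : ℕ} (h : EuclideanSpace ℝ (Fin d)) (n : ℕ)
    (f : smoothFunctions d) (x : EuclideanSpace ℝ (Fin d)) :
    ((dirDerivEnd h ^ n) f : EuclideanSpace ℝ (Fin d) → ℝ) x =
      ∑ β ∈ Finset.Nat.antidiagonalTuple d n,
        Nat.multinomial Finset.univ β * (∏ i, h i ^ β i) * Dmulti β f x := by
  have hcomm : ((Finset.univ : Finset (Fin d)) : Set (Fin d)).Pairwise
      (Function.onFun Commute fun i => h i • pderivEnd i) := fun i _ j _ _ =>
    ((commute_pderivEnd i j).smul_left (h i)).smul_right (h j)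
  have hidx : Finset.piAntidiag Finset.univ n = Finset.Nat.antidiagonalTuple d n := by
    ext β
    simp [Finset.Nat.mem_antidiagonalTuple]
  rw [dirDerivEnd, Finset.sum_pow_eq_sum_piAntidiag_of_commute _ _ hcomm, hidx]
  rw [LinearMap.sum_apply, Submodule.coe_sum, Finset.sum_apply]
  refine Finset.sum_congr rfl fun β _ => ?_
  have hprod : ∀ comm, Finset.univ.noncommProd (fun i => (h i • pderivEnd i) ^ β i) comm =
      (∏ i, h i ^ β i) • ((List.finRange d).map fun i => pderivEnd i ^ β i).prod := by
    rw [← List.toFinset_finRange]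
    intro comm
    rw [Finset.noncommProd_toFinset _ _ _ (List.nodup_finRange d)]
    simp only [smul_pow]
    rw [List.prod_map_smul_eq, List.prod_toFinset _ (List.nodup_finRange d)]
  rw [hprod, ← nsmul_eq_mul, ← Nat.cast_smul_eq_nsmul ℝ, smul_smul]
  simp only [LinearMap.smul_apply, Submodule.coe_smul, Pi.smul_apply, coe_prod_pderivEnd_pow,
    smul_eq_mul]

theorem hasDerivAt_dirDerivEnd_pow {d : ℕ} (h x : EuclideanSpace ℝ (Fin d)) (n : ℕ)
    (f : smoothFunctions d) (t : ℝ) :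
    HasDerivAt (fun t : ℝ => ((dirDerivEnd h ^ n) f : EuclideanSpace ℝ (Fin d) → ℝ) (x + t • h))
      (((dirDerivEnd h ^ (n + 1)) f : EuclideanSpace ℝ (Fin d) → ℝ) (x + t • h)) t := by
  rw [pow_succ', Module.End.mul_apply, dirDerivEnd_apply]
  have hline : HasDerivAt (fun t : ℝ => x + t • h) h t := by
    simpa using ((hasDerivAt_id t).smul_const h).const_add x
  exact (differentiable_coe_smoothFunctions ((dirDerivEnd h ^ n) f) _).hasFDerivAt.comp_hasDerivAt
    t hline

/-- Taylor's formula with integral remainder, for a sequence of successive derivatives. -/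
theorem taylor_sub_eq_integral {F : ℕ → ℝ → ℝ} (hF : ∀ j t, HasDerivAt (F j) (F (j + 1) t) t)
    (n : ℕ) :
    F 0 1 - ∑ j ∈ Finset.range (n + 1), F j 0 / j.factorial =
      ∫ t in (0 : ℝ)..1, (1 - t) ^ n / n.factorial * F (n + 1) t := by
  have hderiv : ∀ (n : ℕ) (t : ℝ), HasDerivAt
      (fun t => ∑ j ∈ Finset.range (n + 1), (1 - t) ^ j / j.factorial * F j t)
      ((1 - t) ^ n / n.factorial * F (n + 1) t) t := by
    intro n t
    induction n with
    | zero => simpa using hF 0 t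
    | succ n ih =>
      simp only [Finset.sum_range_succ _ (n + 1)]
      have hpow : HasDerivAt (fun t : ℝ => (1 - t) ^ (n + 1) / (n + 1).factorial)
          (-((1 - t) ^ n / n.factorial)) t := by
        refine ((((hasDerivAt_id t).const_sub 1).pow (n + 1)).div_const _).congr_deriv ?_
        rw [Nat.factorial_succ]
        push_cast
        simp only [id]
        field_simp
      refine (ih.add (hpow.mul (hF (n + 1) t))).congr_deriv ?_
      ring
  have hcont : Continuous (F (n + 1)) :=
    continuous_iff_continuousAt.2 fun t => (hF (n + 1) t).continuousAt
  rw [intervalIntegral.integral_eq_sub_of_hasDerivAt (fun t _ => hderiv n t)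
    (Continuous.intervalIntegrable (by fun_prop) _ _)]
  congr 1
  · rw [Finset.sum_eq_single_of_mem 0 (by simp) (fun j _ hj => by simp [hj])]
    simp
  · refine Finset.sum_congr rfl fun j _ => ?_
    simp [div_eq_inv_mul]

theorem enorm_taylor_sub_le {F : ℕ → ℝ → ℝ} (hF : ∀ j t, HasDerivAt (F j) (F (j + 1) t) t)
    {s : ℕ} (hs : 1 ≤ s) :
    ‖F 0 1 - ∑ j ∈ Finset.range s, F j 0 / j.factorial‖ₑ ≤
      ∫⁻ t in Set.Icc (0 : ℝ) 1, ‖F s t‖ₑ := by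
  obtain ⟨n, rfl⟩ := Nat.exists_eq_add_of_le' hs
  rw [taylor_sub_eq_integral hF, intervalIntegral.integral_of_le zero_le_one,
    ← integral_Icc_eq_integral_Ioc]
  refine (enorm_integral_le_lintegral_enorm _).trans
    (setLIntegral_mono' measurableSet_Icc fun t ht => ?_)
  rw [enorm_le_iff_norm_le, norm_mul]
  refine mul_le_of_le_one_left (norm_nonneg _) ?_
  have h0 : 0 ≤ 1 - t := by linarith [ht.2]
  rw [Real.norm_of_nonneg (by positivity)]
  refine div_le_one_of_le₀ ?_ (by positivity)
  exact (pow_le_one₀ h0 (by linarith [ht.1])).trans (by exact_mod_cast n.factorial_pos)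

/-- Minkowski's integral inequality in `L²` for a superposition of translates. -/
theorem eLpNorm_lintegral_translate_le {d : ℕ} {Y : Type*} [MeasurableSpace Y] (μ : Measure Y)
    [SFinite μ] {a : Y → EuclideanSpace ℝ (Fin d)} (ha : Measurable a)
    {g : EuclideanSpace ℝ (Fin d) → ENNReal} (hg : Measurable g) :
    eLpNorm (fun x => ∫⁻ y, g (x - a y) ∂μ) 2 volume ≤ μ Set.univ * eLpNorm g 2 volume := by
  have hjensen : ∀ x, (∫⁻ y, g (x - a y) ∂μ) ^ 2 ≤ μ Set.univ * ∫⁻ y, g (x - a y) ^ 2 ∂μ := by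
    intro x
    have h := ENNReal.lintegral_mul_le_Lp_mul_Lq μ Real.HolderConjugate.two_two
      (f := fun _ => 1) (g := fun y => g (x - a y)) aemeasurable_const (by fun_prop)
    have h2 := pow_le_pow_left' h 2
    rw [mul_pow, ← ENNReal.rpow_mul_natCast, ← ENNReal.rpow_mul_natCast] at h2
    simpa using h2
  have hsq : ∀ f : EuclideanSpace ℝ (Fin d) → ENNReal,
      eLpNorm f 2 volume ^ 2 = ∫⁻ x, f x ^ 2 := by
    intro f
    rw [eLpNorm_eq_lintegral_rpow_enorm_toReal (by simp) (by simp), ← ENNReal.rpow_mul_natCast]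
    simp
  rw [← ENNReal.pow_le_pow_left_iff two_ne_zero, mul_pow, hsq, hsq]
  calc ∫⁻ x, (∫⁻ y, g (x - a y) ∂μ) ^ 2
      ≤ ∫⁻ x, μ Set.univ * ∫⁻ y, g (x - a y) ^ 2 ∂μ := lintegral_mono hjensen
    _ = μ Set.univ * ∫⁻ y, (∫⁻ x, g (x - a y) ^ 2) ∂μ := by
      rw [lintegral_const_mul _ (by fun_prop), lintegral_lintegral_swap (by fun_prop)]
    _ = μ Set.univ ^ 2 * ∫⁻ x, g x ^ 2 := by
      simp_rw [lintegral_sub_right_eq_self (fun x => g x ^ 2)]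
      rw [lintegral_const]
      ring

theorem integrable_mul_of_essBounded_of_support_subset {d : ℕ} {r : ℝ}
    {ψ : EuclideanSpace ℝ (Fin d) → ℝ} (hmeas : Measurable ψ)
    (hbd : eLpNorm ψ ⊤ volume ≠ ⊤)
    (hsupp : ∀ x, x ∉ Metric.closedBall 0 r → ψ x = 0)
    {q : EuclideanSpace ℝ (Fin d) → ℝ} (hq : Continuous q) :
    Integrable (fun z => ψ z * q z) := by
  have hK : IsCompact (Metric.closedBall (0 : EuclideanSpace ℝ (Fin d)) r) :=
    isCompact_closedBall _ _
  have hψ : IntegrableOn ψ (Metric.closedBall 0 r) := by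
    have : IsFiniteMeasure (volume.restrict
        (Metric.closedBall (0 : EuclideanSpace ℝ (Fin d)) r)) :=
      ⟨by simpa using hK.measure_lt_top⟩
    exact MemLp.integrable (q := ⊤) le_top
      (MemLp.restrict _ ⟨hmeas.aestronglyMeasurable, hbd.lt_top⟩)
  refine (integrableOn_iff_integrable_of_support_subset ?_).1
    (hψ.mul_continuousOn hq.continuousOn hK)
  intro z hz
  by_contra hzK
  exact hz (by simp [hsupp z hzK])

theorem integral_scaledKernel_mul {d : ℕ} (ψ v : EuclideanSpace ℝ (Fin d) → ℝ) {ε : ℝ}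
    (hε : 0 < ε) (x : EuclideanSpace ℝ (Fin d)) :
    ∫ y, scaledKernel d ψ ε (x - y) * v y = ∫ z, ψ z * v (x - ε • z) := by
  rw [← integral_sub_left_eq_self _ volume x]
  have h := Measure.integral_comp_inv_smul_of_nonneg volume
    (fun z => (ε ^ d)⁻¹ * (ψ z * v (x - ε • z))) hε.le
  simp only [smul_inv_smul₀ hε.ne', finrank_euclideanSpace, Fintype.card_fin,
    integral_const_mul, smul_eq_mul] at h
  rw [mul_inv_cancel_left₀ (by positivity)] at h
  rw [← h, ← integral_const_mul]
  refine integral_congr_ae (.of_forall fun y => ?_)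
  simp only [scaledKernel, sub_sub_cancel]
  ring

theorem abs_prod_pow_le_norm_pow {d : ℕ} (h : EuclideanSpace ℝ (Fin d)) (β : Fin d → ℕ) :
    |∏ i, h i ^ β i| ≤ ‖h‖ ^ ∑ i, β i := by
  rw [Finset.abs_prod, ← Finset.prod_pow_eq_pow_sum]
  refine Finset.prod_le_prod (fun i _ => abs_nonneg _) fun i _ => ?_
  rw [abs_pow]
  exact pow_le_pow_left₀ (abs_nonneg _) (PiLp.norm_apply_le h i) _

/-- The sum of the absolute values of all partial derivatives of order `s`, weighted by multinomial
coefficients. -/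
noncomputable def derivSum {d : ℕ} (s : ℕ) (v : EuclideanSpace ℝ (Fin d) → ℝ)
    (x : EuclideanSpace ℝ (Fin d)) : ENNReal :=
  ∑ β ∈ Finset.Nat.antidiagonalTuple d s, (Nat.multinomial Finset.univ β : ENNReal) *
    ‖Dmulti β v x‖ₑ

theorem measurable_derivSum {d : ℕ} (s : ℕ) {v : EuclideanSpace ℝ (Fin d) → ℝ}
    (hv : ContDiff ℝ (⊤ : ℕ∞) v) : Measurable (derivSum s v) :=
  Finset.measurable_fun_sum _ fun β _ =>
    ((contDiff_Dmulti β hv).continuous.measurable.enorm).const_mul _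

theorem eLpNorm_derivSum_le {d : ℕ} (s : ℕ) {v : EuclideanSpace ℝ (Fin d) → ℝ}
    (hv : ContDiff ℝ (⊤ : ℕ∞) v) :
    eLpNorm (derivSum s v) 2 volume ≤ ENNReal.ofReal s.factorial *
      ∑ β ∈ Finset.Nat.antidiagonalTuple d s, eLpNorm (Dmulti β v) 2 volume := by
  have hsum : derivSum s v = ∑ β ∈ Finset.Nat.antidiagonalTuple d s,
      fun x => (Nat.multinomial Finset.univ β : ENNReal) * ‖Dmulti β v x‖ₑ := by
    ext x
    simp [derivSum]
  rw [hsum, Finset.mul_sum]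
  refine (eLpNorm_sum_le (fun β _ => (((contDiff_Dmulti β hv).continuous.measurable.enorm).const_mul
    _).aestronglyMeasurable) (by norm_num)).trans (Finset.sum_le_sum fun β hβ => ?_)
  have hmult : Nat.multinomial Finset.univ β ≤ s.factorial := by
    rw [Nat.multinomial, Finset.Nat.mem_antidiagonalTuple.1 hβ]
    exact Nat.div_le_self _ _
  rw [ENNReal.ofReal_natCast]
  exact eLpNorm_le_mul_eLpNorm_of_ae_le_mul'' (c := s.factorial) 2
    (contDiff_Dmulti β hv).continuous.aestronglyMeasurable
    (.of_forall fun x => by rw [enorm_eq_self]; gcongr)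

theorem enorm_dirDerivEnd_pow_le {d : ℕ} (h : EuclideanSpace ℝ (Fin d)) (n : ℕ)
    (f : smoothFunctions d) (x : EuclideanSpace ℝ (Fin d)) :
    ‖((dirDerivEnd h ^ n) f : EuclideanSpace ℝ (Fin d) → ℝ) x‖ₑ ≤
      ENNReal.ofReal (‖h‖ ^ n) * derivSum n f x := by
  rw [dirDerivEnd_pow_apply, derivSum, Finset.mul_sum]
  refine (enorm_sum_le _ _).trans (Finset.sum_le_sum fun β hβ => ?_)
  rw [enorm_mul, enorm_mul, mul_left_comm, ← mul_assoc]
  gcongr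
  · simp
  · rw [Real.enorm_eq_ofReal_abs]
    refine ENNReal.ofReal_le_ofReal ?_
    rw [← Finset.Nat.mem_antidiagonalTuple.1 hβ]
    exact abs_prod_pow_le_norm_pow h β

theorem continuous_dirDerivEnd_pow_smul {d : ℕ} (c : ℝ) (n : ℕ) (f : smoothFunctions d)
    (x : EuclideanSpace ℝ (Fin d)) :
    Continuous fun z => ((dirDerivEnd (c • z) ^ n) f : EuclideanSpace ℝ (Fin d) → ℝ) x := by
  simp only [dirDerivEnd_pow_apply, PiLp.smul_apply]
  fun_prop

/-- The Taylor terms of positive order at most `k` are annihilated by a kernel of order `k`. -/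
theorem integral_mul_dirDerivEnd_pow_eq_zero {d k : ℕ} {r : ℝ}
    {ψ : EuclideanSpace ℝ (Fin d) → ℝ} (hmeas : Measurable ψ)
    (hbd : eLpNorm ψ ⊤ volume ≠ ⊤)
    (hsupp : ∀ x, x ∉ Metric.closedBall 0 r → ψ x = 0)
    (hmom : ∀ β : Fin d → ℕ, 1 ≤ ∑ i, β i → ∑ i, β i ≤ k →
      (∫ y : EuclideanSpace ℝ (Fin d), (∏ i, y i ^ β i) * ψ y) = 0)
    (c : ℝ) {n : ℕ} (hn : 1 ≤ n) (hnk : n ≤ k) (f : smoothFunctions d)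
    (x : EuclideanSpace ℝ (Fin d)) :
    ∫ z, ψ z * ((dirDerivEnd (c • z) ^ n) f : EuclideanSpace ℝ (Fin d) → ℝ) x = 0 := by
  simp only [dirDerivEnd_pow_apply, PiLp.smul_apply, Finset.mul_sum]
  rw [integral_finsetSum _ fun β _ => integrable_mul_of_essBounded_of_support_subset hmeas hbd hsupp
    (by fun_prop)]
  refine Finset.sum_eq_zero fun β hβ => ?_
  have hβn := Finset.Nat.mem_antidiagonalTuple.1 hβ
  have hrw : ∀ z : EuclideanSpace ℝ (Fin d),
      ψ z * (Nat.multinomial Finset.univ β * (∏ i, (c • z i) ^ β i) * Dmulti β f x) =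
        (Nat.multinomial Finset.univ β * (∏ i, c ^ β i) * Dmulti β f x) *
          ((∏ i, z i ^ β i) * ψ z) := by
    intro z
    simp only [smul_eq_mul, mul_pow, Finset.prod_mul_distrib]
    ring
  simp only [hrw, integral_const_mul, hmom β (by omega) (by omega), mul_zero]

/-- Pointwise bound for the regularization error. -/
theorem enorm_regularization_error_le {d k : ℕ} {r : ℝ}
    {ψ : EuclideanSpace ℝ (Fin d) → ℝ} (hmeas : Measurable ψ)
    (hbd : eLpNorm ψ ⊤ volume ≠ ⊤)
    (hsupp : ∀ x, x ∉ Metric.closedBall 0 r → ψ x = 0)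
    (hunit : (∫ y : EuclideanSpace ℝ (Fin d), ψ y) = 1)
    (hmom : ∀ β : Fin d → ℕ, 1 ≤ ∑ i, β i → ∑ i, β i ≤ k →
      (∫ y : EuclideanSpace ℝ (Fin d), (∏ i, y i ^ β i) * ψ y) = 0)
    {s : ℕ} (hs1 : 1 ≤ s) (hsk : s ≤ k + 1) {ε : ℝ} (hε : 0 < ε)
    {v : EuclideanSpace ℝ (Fin d) → ℝ} (hv : ContDiff ℝ (⊤ : ℕ∞) v)
    (x : EuclideanSpace ℝ (Fin d)) :
    ‖v x - ∫ y, scaledKernel d ψ ε (x - y) * v y‖ₑ ≤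
      ENNReal.ofReal ((ε * r) ^ s) *
        ∫⁻ z, ‖ψ z‖ₑ * ∫⁻ t in Set.Icc (0 : ℝ) 1, derivSum s v (x - (t * ε) • z) := by
  let f : smoothFunctions d := ⟨v, hv⟩
  let P : ℕ → EuclideanSpace ℝ (Fin d) → ℝ := fun j z =>
    ((dirDerivEnd ((-ε) • z) ^ j) f : EuclideanSpace ℝ (Fin d) → ℝ) x
  have hint : ∀ {q : EuclideanSpace ℝ (Fin d) → ℝ}, Continuous q →
      Integrable (fun z => ψ z * q z) :=
    integrable_mul_of_essBounded_of_support_subset hmeas hbd hsupp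
  have hP : ∀ j, Continuous (P j) := fun j => continuous_dirDerivEnd_pow_smul (-ε) j f x
  have hpoly : ∫ z, ψ z * ∑ j ∈ Finset.range s, P j z / j.factorial = v x := by
    simp only [Finset.mul_sum]
    rw [integral_finsetSum _ fun j _ => hint ((hP j).div_const _),
      Finset.sum_eq_single_of_mem 0 (Finset.mem_range.2 hs1)]
    · simp [P, f, integral_mul_const, hunit]
    · intro j hj hj0
      have hzero : ∫ z, ψ z * P j z = 0 :=
        integral_mul_dirDerivEnd_pow_eq_zero hmeas hbd hsupp hmom (-ε)
          (Nat.one_le_iff_ne_zero.2 hj0) (by have := Finset.mem_range.1 hj; omega) f x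
      simp only [mul_div_assoc', integral_div, hzero, zero_div]
  have hvcont : Continuous fun z => v (x - ε • z) := hv.continuous.comp (by fun_prop)
  have herr : v x - ∫ y, scaledKernel d ψ ε (x - y) * v y =
      -∫ z, ψ z * (v (x - ε • z) - ∑ j ∈ Finset.range s, P j z / j.factorial) := by
    simp only [mul_sub]
    rw [integral_sub (hint hvcont)
      (hint (continuous_finsetSum _ fun j _ => (hP j).div_const _)), hpoly,
      integral_scaledKernel_mul ψ v hε x, neg_sub]
  rw [herr, enorm_neg, ← lintegral_const_mul' _ _ ENNReal.ofReal_ne_top]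
  refine (enorm_integral_le_lintegral_enorm _).trans (lintegral_mono fun z => ?_)
  by_cases hz : z ∈ Metric.closedBall 0 r
  swap
  · simp [hsupp z hz]
  have htaylor := enorm_taylor_sub_le
    (fun j t => hasDerivAt_dirDerivEnd_pow ((-ε) • z) x j f t) hs1
  simp only [pow_zero, Module.End.one_apply, one_smul, zero_smul, add_zero] at htaylor
  rw [enorm_mul, mul_left_comm]
  gcongr
  rw [sub_eq_add_neg x, ← neg_smul]
  refine htaylor.trans ?_
  rw [← lintegral_const_mul' _ _ ENNReal.ofReal_ne_top]
  refine lintegral_mono fun t => (enorm_dirDerivEnd_pow_le _ _ _ _).trans ?_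
  have hzr : ‖z‖ ≤ r := by simpa using hz
  rw [smul_smul, mul_neg, neg_smul (t * ε), ← sub_eq_add_neg, norm_smul, norm_neg,
    Real.norm_of_nonneg hε.le]
  gcongr

/-- for `ψ` satisfying the approximate-Dirac assumptions of order `k`, and for each
integer `1 ≤ s ≤ k+1` there is a constant `C` such that for all `ε > 0` and all smooth compactly
supported `v`, `‖v − δ_ε ⋆ v‖_{L²} ≤ C ε^s Σ_{|β|=s} ‖D^β v‖_{L²}`. -/
theorem regularization_L2_error_Rd
    (d : ℕ) (hd : 1 ≤ d) (k : ℕ) (r0 : ℝ) (hr0 : 0 < r0)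
    (ψ : EuclideanSpace ℝ (Fin d) → ℝ)
    (hmeas : Measurable ψ)
    (hbd : eLpNorm ψ ⊤ volume ≠ ⊤)
    (hsupp : ∀ x : EuclideanSpace ℝ (Fin d), x ∉ Metric.closedBall 0 r0 → ψ x = 0)
    (hunit : (∫ y : EuclideanSpace ℝ (Fin d), ψ y) = 1)
    (hmom : ∀ β : Fin d → ℕ, 1 ≤ ∑ i, β i → ∑ i, β i ≤ k →
      (∫ y : EuclideanSpace ℝ (Fin d), (∏ i, y i ^ β i) * ψ y) = 0)
    (s : ℕ) (hs1 : 1 ≤ s) (hsk : s ≤ k + 1) :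
    ∃ C : ℝ, 0 < C ∧ ∀ ε : ℝ, 0 < ε →
      ∀ v : EuclideanSpace ℝ (Fin d) → ℝ, ContDiff ℝ (⊤ : ℕ∞) v → HasCompactSupport v →
        eLpNorm
            (fun x => v x - ∫ y : EuclideanSpace ℝ (Fin d), scaledKernel d ψ ε (x - y) * v y)
            2 volume ≤
          ENNReal.ofReal (C * ε ^ s) *
            ∑ β ∈ Finset.Nat.antidiagonalTuple d s, eLpNorm (Dmulti β v) 2 volume := by
  have hψ : Integrable ψ := by
    simpa using integrable_mul_of_essBounded_of_support_subset hmeas hbd hsupp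
      (continuous_const (y := (1 : ℝ)))
  have hmass : ∫⁻ z, ‖ψ z‖ₑ = ENNReal.ofReal (∫ z, ‖ψ z‖) :=
    (ofReal_integral_norm_eq_lintegral_enorm hψ).symm
  have hmass_pos : 0 < ∫ z, ‖ψ z‖ := by
    have h := norm_integral_le_integral_norm (μ := volume) ψ
    rw [hunit, norm_one] at h
    linarith
  refine ⟨r0 ^ s * (∫ z, ‖ψ z‖) * s.factorial, by positivity, fun ε hε v hv _ => ?_⟩
  let μ : Measure (EuclideanSpace ℝ (Fin d) × ℝ) :=
    (volume.withDensity fun z => ‖ψ z‖ₑ).prod (volume.restrict (Set.Icc 0 1))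
  have hμ : μ Set.univ = ENNReal.ofReal (∫ z, ‖ψ z‖) := by
    simp [μ, ← Set.univ_prod_univ, Measure.prod_prod, hmass]
  have hg := measurable_derivSum s hv
  have hsuper : ∀ x, ∫⁻ z, ‖ψ z‖ₑ * ∫⁻ t in Set.Icc (0 : ℝ) 1, derivSum s v (x - (t * ε) • z) =
      ∫⁻ p, derivSum s v (x - (p.2 * ε) • p.1) ∂μ := by
    intro x
    rw [lintegral_prod _ (by fun_prop), lintegral_withDensity_eq_lintegral_mul _ hmeas.enorm
      (Measurable.lintegral_prod_right' (f := fun p : EuclideanSpace ℝ (Fin d) × ℝ =>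
        derivSum s v (x - (p.2 * ε) • p.1)) (by fun_prop))]
    rfl
  calc eLpNorm (fun x => v x - ∫ y, scaledKernel d ψ ε (x - y) * v y) 2 volume
      ≤ ENNReal.ofReal ((ε * r0) ^ s) *
          eLpNorm (fun x => ∫⁻ p, derivSum s v (x - (p.2 * ε) • p.1) ∂μ) 2 volume := by
        refine eLpNorm_le_mul_eLpNorm_of_ae_le_mul'' 2
          (Measurable.lintegral_prod_right' (f := fun q : EuclideanSpace ℝ (Fin d) ×
            (EuclideanSpace ℝ (Fin d) × ℝ) => derivSum s v (q.1 - (q.2.2 * ε) • q.2.1))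
            (by fun_prop)).aestronglyMeasurable
          (.of_forall fun x => ?_)
        rw [enorm_eq_self, ← hsuper]
        exact enorm_regularization_error_le hmeas hbd hsupp hunit hmom hs1 hsk hε hv x
    _ ≤ ENNReal.ofReal ((ε * r0) ^ s) * (ENNReal.ofReal (∫ z, ‖ψ z‖) *
          (ENNReal.ofReal s.factorial *
            ∑ β ∈ Finset.Nat.antidiagonalTuple d s, eLpNorm (Dmulti β v) 2 volume)) := by
        gcongr
        rw [← hμ]
        refine (eLpNorm_lintegral_translate_le μ (by fun_prop) hg).trans ?_
        gcongr
        exact eLpNorm_derivSum_le s hv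
    _ = _ := by
        rw [← mul_assoc, ← mul_assoc, ← ENNReal.ofReal_mul (by positivity),
          ← ENNReal.ofReal_mul (by positivity)]
        congr 2
        ring
end

section
/- Let V and H be real Hilbert spaces and ι : V → H a continuous linear map. Let B : V × V → ℝ be a bilinear form with |B(v, w)| ≤ M ‖v‖_V ‖w‖_V for all v, w ∈ V, let V_h ⊆ V be a closed subspace, and let e ∈ V satisfy the Galerkin orthogonality B(e, v_h) = 0 for all v_h ∈ V_h (i.e. e = u − u_h for conforming Galerkin approximation). Suppose z ∈ V solves the dual problem B(v, z) = ⟨ι v, ι e⟩_H for all v ∈ V, and suppose there exist η ≥ 0 and z_h ∈ V_h with ‖z − z_h‖_V ≤ η ‖ι e‖_H. Then ‖ι e‖_H ≤ M η ‖e‖_V. (This is the Aubin–Nitsche duality argument used to derive the L² error estimates from the H¹ ones.) -/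
open scoped RealInnerProductSpace

/-- Aubin–Nitsche duality argument: if `B(e, ⋅)` vanishes on the closed subspace
`V_h` (Galerkin orthogonality), `z` solves the dual problem `B(v, z) = ⟨ιv, ιe⟩_H`, and `z` can
be approximated in `V_h` to accuracy `η ‖ιe‖_H`, then `‖ιe‖_H ≤ M η ‖e‖_V`. -/
theorem aubin_nitsche_duality
    {V H : Type*}
    [NormedAddCommGroup V] [InnerProductSpace ℝ V] [CompleteSpace V]
    [NormedAddCommGroup H] [InnerProductSpace ℝ H] [CompleteSpace H]
    (ι : V →L[ℝ] H)
    (B : V →ₗ[ℝ] V →ₗ[ℝ] ℝ)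
    (M : ℝ) (hM : 0 < M)
    (hbdd : ∀ v w : V, |B v w| ≤ M * ‖v‖ * ‖w‖)
    (Vh : Submodule ℝ V) (hVh : IsClosed (Vh : Set V))
    (e : V) (hGal : ∀ vh ∈ Vh, B e vh = 0)
    (z : V) (hz : ∀ v : V, B v z = ⟪ι v, ι e⟫)
    (η : ℝ) (hη : 0 ≤ η)
    (zh : V) (hzh : zh ∈ Vh) (happrox : ‖z - zh‖ ≤ η * ‖ι e‖) :
    ‖ι e‖ ≤ M * η * ‖e‖ := by
  rcases (norm_nonneg (ι e)).eq_or_lt with h0 | hpos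
  · rw [← h0]
    positivity
  · refine le_of_mul_le_mul_right ?_ hpos
    calc ‖ι e‖ * ‖ι e‖ = B e (z - zh) := by
          rw [map_sub, hGal zh hzh, sub_zero, hz e, real_inner_self_eq_norm_mul_norm]
      _ ≤ M * ‖e‖ * ‖z - zh‖ := (le_abs_self _).trans (hbdd e (z - zh))
      _ ≤ M * ‖e‖ * (η * ‖ι e‖) := by gcongr
      _ = M * η * ‖e‖ * ‖ι e‖ := by ring
end
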